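/- Asymptotically optimal sequences collapse to Kelly: Fix α ∈ (0,1). Let (ε_n) be a sequence of nonnegative reals with ε_n → 0, and let W_n ∈ W̄ satisfy Q_{n,α}(W_n) ≥ exp(−n·ε_n) · sup_{W ∈ W̄} Q_{n,α}(W) for every n. Then W_n → W^K as n → ∞, where W^K_i = p_i/q_i. Moreover the Kelly point itself is asymptotically optimal: (1/n)·log Q_{n,α}(W^K) − (1/n)·log( sup_{W ∈ W̄} Q_{n,α}(W) ) → 0 as n → ∞. -/

import Mathlib

open Finset Filter Topology
open scoped Classical

noncomputable section

/-- The closed Arrow–Debreu wealth simplex `{W ∈ [0,∞)^m : Σ q_i W_i = 1}`. -/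
def closedSimplex {m : ℕ} (q : Fin m → ℝ) : Set (Fin m → ℝ) :=
  {W | (∀ i, 0 ≤ W i) ∧ ∑ i, q i * W i = 1}

/-- The open Arrow–Debreu wealth simplex `{W ∈ (0,∞)^m : Σ q_i W_i = 1}`. -/
def openSimplex {m : ℕ} (q : Fin m → ℝ) : Set (Fin m → ℝ) :=
  {W | (∀ i, 0 < W i) ∧ ∑ i, q i * W i = 1}

/-- The finite set `C_n` of count vectors `k : Fin m → ℕ` with `Σ k_i = n`. -/
def countFinset (m n : ℕ) : Finset (Fin m → ℕ) :=
  (Fintype.piFinset fun _ : Fin m => Finset.range (n + 1)).filter fun k => ∑ i, k i = n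

/-- The monomial `W^k := Π_i W_i^{k_i}` (with the convention `0^0 = 1`). -/
def mono {m : ℕ} (W : Fin m → ℝ) (k : Fin m → ℕ) : ℝ := ∏ i, W i ^ k i

/-- The multinomial probability `π_k = (n!/(k_1!⋯k_m!))·Π p_i^{k_i}`. -/
def countProb {m : ℕ} (p : Fin m → ℝ) (k : Fin m → ℕ) : ℝ :=
  (Nat.multinomial Finset.univ k : ℝ) * ∏ i, p i ^ k i

/-- The upper α-quantile of terminal wealth
`Q_{n,α}(W) := sup{t ∈ [0,∞) : Σ_{k ∈ C_n : W^k ≥ t} π_k ≥ α}`. -/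
def upperQuantile {m : ℕ} (p : Fin m → ℝ) (n : ℕ) (α : ℝ) (W : Fin m → ℝ) : ℝ :=
  sSup {t : ℝ | 0 ≤ t ∧
    α ≤ ∑ k ∈ countFinset m n, if t ≤ mono W k then countProb p k else 0}

/-- The union of the count hyperplanes `H_{k,ℓ}`. -/
def hyperUnion (m n : ℕ) : Set (Fin m → ℝ) :=
  {u | ∃ k ∈ countFinset m n, ∃ l ∈ countFinset m n,
    k ≠ l ∧ ∑ i, ((k i : ℝ) - (l i : ℝ)) * u i = 0}

/-- A chamber is a connected component of the complement of the count arrangement. -/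
def IsChamber (m n : ℕ) (Γ : Set (Fin m → ℝ)) : Prop :=
  ∃ u ∈ (hyperUnion m n)ᶜ, Γ = connectedComponentIn (hyperUnion m n)ᶜ u

/-- `F_Γ := {W ∈ W⁺⁺ : log W ∈ Γ}`. -/
def chamberFace {m : ℕ} (q : Fin m → ℝ) (Γ : Set (Fin m → ℝ)) : Set (Fin m → ℝ) :=
  {W | W ∈ openSimplex q ∧ (fun i => Real.log (W i)) ∈ Γ}

/-- `k` is the quantile count vector `k_{α,Γ}` of the chamber `Γ`: the tail mass at `W^k`
is at least `α`, while the strict tail mass is below `α`, for every `W ∈ F_Γ`. -/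
def IsQuantileVec {m : ℕ} (p q : Fin m → ℝ) (n : ℕ) (α : ℝ) (Γ : Set (Fin m → ℝ))
    (k : Fin m → ℕ) : Prop :=
  k ∈ countFinset m n ∧
  ∀ W ∈ chamberFace q Γ,
    α ≤ (∑ l ∈ countFinset m n, if mono W k ≤ mono W l then countProb p l else 0) ∧
    (∑ l ∈ countFinset m n, if mono W k < mono W l then countProb p l else 0) < α

theorem countFinset_eq_piAntidiag (m n : ℕ) :
    countFinset m n = Finset.piAntidiag Finset.univ n := by
  ext k
  simp only [countFinset, Finset.mem_filter, Fintype.mem_piFinset, Finset.mem_range,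
    Finset.mem_piAntidiag, Finset.mem_univ, implies_true, and_true, and_iff_right_iff_imp]
  intro h i
  have := Finset.single_le_sum (f := k) (fun j _ => Nat.zero_le _) (Finset.mem_univ i)
  omega

theorem sum_eq_of_mem_countFinset {m n : ℕ} {k : Fin m → ℕ} (hk : k ∈ countFinset m n) :
    ∑ i, k i = n :=
  (Finset.mem_filter.mp hk).2

/-- The generating function of the multinomial distribution. -/
theorem sum_countProb_mul_prod_pow {m : ℕ} (p y : Fin m → ℝ) (n : ℕ) :
    ∑ k ∈ countFinset m n, countProb p k * ∏ i, y i ^ k i = (∑ i, p i * y i) ^ n := by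
  rw [Finset.sum_pow_eq_sum_piAntidiag, countFinset_eq_piAntidiag]
  refine Finset.sum_congr rfl fun k _ => ?_
  simp only [countProb, mul_pow, Finset.prod_mul_distrib]
  ring

theorem countProb_nonneg {m : ℕ} {p : Fin m → ℝ} (hp : ∀ i, 0 ≤ p i) (k : Fin m → ℕ) :
    0 ≤ countProb p k :=
  mul_nonneg (Nat.cast_nonneg _) (Finset.prod_nonneg fun i _ => pow_nonneg (hp i) _)

theorem sum_countProb {m : ℕ} {p : Fin m → ℝ} (hp : ∑ i, p i = 1) (n : ℕ) :
    ∑ k ∈ countFinset m n, countProb p k = 1 := by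
  simpa [hp] using sum_countProb_mul_prod_pow p (fun _ => 1) n

theorem bddAbove_upperQuantile_set {m : ℕ} (p W : Fin m → ℝ) (n : ℕ) {α : ℝ} (hα : 0 < α) :
    BddAbove {t : ℝ | 0 ≤ t ∧
      α ≤ ∑ k ∈ countFinset m n, if t ≤ mono W k then countProb p k else 0} := by
  refine ⟨∑ k ∈ countFinset m n, |mono W k|, fun t ⟨_, ht⟩ => ?_⟩
  by_contra! hlt
  refine absurd ht (not_le.mpr (lt_of_eq_of_lt (Finset.sum_eq_zero fun k hk => ?_) hα))
  refine if_neg (not_le.mpr (lt_of_le_of_lt ?_ hlt))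
  exact (le_abs_self _).trans
    (Finset.single_le_sum (f := fun k => |mono W k|) (fun _ _ => abs_nonneg _) hk)

theorem exists_pos_sum_mul_exp_lt_one {m : ℕ} {p b : Fin m → ℝ} (hp : ∑ i, p i = 1)
    (hb : ∑ i, p i * b i < 0) : ∃ s > 0, ∑ i, p i * Real.exp (s * b i) < 1 := by
  have hd : HasDerivAt (fun s : ℝ => ∑ i, p i * Real.exp (s * b i)) (∑ i, p i * b i) 0 := by
    have : ∀ i ∈ (Finset.univ : Finset (Fin m)),
        HasDerivAt (fun s : ℝ => p i * Real.exp (s * b i)) (p i * b i) 0 := by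
      intro i _
      simpa using (((hasDerivAt_id (0 : ℝ)).mul_const (b i)).exp).const_mul (p i)
    exact HasDerivAt.fun_sum this
  have hlt : ∀ᶠ s in 𝓝[>] (0 : ℝ), slope (fun s : ℝ => ∑ i, p i * Real.exp (s * b i)) 0 s < 0 :=
    ((hasDerivAt_iff_tendsto_slope.mp hd).mono_left
      (nhdsWithin_mono _ fun x hx => ne_of_gt hx)).eventually_lt_const hb
  obtain ⟨s, hs, hs0⟩ := (hlt.and self_mem_nhdsWithin).exists
  have hs0 : 0 < s := hs0
  refine ⟨s, hs0, ?_⟩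
  simp only [slope_def_field, zero_mul, Real.exp_zero, mul_one, hp, sub_zero] at hs
  have := (div_lt_iff₀ hs0).mp hs
  linarith

theorem prod_exp_pow {m : ℕ} (s : ℝ) (b : Fin m → ℝ) (k : Fin m → ℕ) :
    ∏ i, Real.exp (s * b i) ^ k i = Real.exp (s * ∑ i, k i * b i) := by
  rw [Finset.mul_sum, Real.exp_sum]
  refine Finset.prod_congr rfl fun i _ => ?_
  rw [← Real.exp_nat_mul]
  congr 1
  ring

theorem mono_eq_exp {m : ℕ} {V : Fin m → ℝ} (hV : ∀ i, 0 < V i) (k : Fin m → ℕ) :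
    mono V k = Real.exp (∑ i, k i * Real.log (V i)) := by
  rw [Real.exp_sum]
  refine Finset.prod_congr rfl fun i _ => ?_
  rw [Real.exp_nat_mul, Real.exp_log (hV i)]

theorem sum_count_mul_sub {m n : ℕ} {k : Fin m → ℕ} (hk : k ∈ countFinset m n)
    (a : Fin m → ℝ) (c : ℝ) : ∑ i, (k i : ℝ) * (a i - c) = (∑ i, k i * a i) - n * c := by
  rw [← sum_eq_of_mem_countFinset hk]
  push_cast
  simp only [mul_sub, Finset.sum_sub_distrib, Finset.sum_mul]

/-- Growth rate of the quantile from below, by a Chernoff bound. -/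
theorem eventually_exp_le_upperQuantile {m : ℕ} {p V : Fin m → ℝ} (hp : ∀ i, 0 < p i)
    (hpsum : ∑ i, p i = 1) (hV : ∀ i, 0 < V i) {α : ℝ} (hα0 : 0 < α) (hα1 : α < 1)
    {δ : ℝ} (hδ : 0 < δ) :
    ∀ᶠ n : ℕ in atTop,
      Real.exp (n * ((∑ i, p i * Real.log (V i)) - δ)) ≤ upperQuantile p n α V := by
  set h := ∑ i, p i * Real.log (V i) with hh
  have hb : ∑ i, p i * (-(Real.log (V i) - (h - δ))) < 0 := by
    simp only [mul_neg, Finset.sum_neg_distrib]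
    simp only [mul_sub, Finset.sum_sub_distrib, ← Finset.sum_mul, hpsum, ← hh]
    linarith
  obtain ⟨s, hs, hs1⟩ := exists_pos_sum_mul_exp_lt_one hpsum hb
  have hs0 : 0 ≤ ∑ i, p i * Real.exp (s * -(Real.log (V i) - (h - δ))) :=
    Finset.sum_nonneg fun i _ => mul_nonneg (hp i).le (Real.exp_pos _).le
  filter_upwards [(tendsto_pow_atTop_nhds_zero_of_lt_one hs0 hs1).eventually_lt_const
    (sub_pos.mpr hα1)] with n hn
  refine le_csSup (bddAbove_upperQuantile_set p V n hα0) ⟨(Real.exp_pos _).le, ?_⟩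
  rw [← sum_countProb_mul_prod_pow] at hn
  have key : ∑ k ∈ countFinset m n, countProb p k ≤
      (∑ k ∈ countFinset m n,
        if Real.exp (n * (h - δ)) ≤ mono V k then countProb p k else 0) +
      ∑ k ∈ countFinset m n, countProb p k *
        ∏ i, Real.exp (s * -(Real.log (V i) - (h - δ))) ^ k i := by
    rw [← Finset.sum_add_distrib]
    refine Finset.sum_le_sum fun k hk => ?_
    have hk0 := countProb_nonneg (fun i => (hp i).le) k
    rw [prod_exp_pow]
    split_ifs with hc
    · exact le_add_of_nonneg_right (mul_nonneg hk0 (Real.exp_pos _).le)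
    · rw [zero_add]
      refine le_mul_of_one_le_right hk0 (Real.one_le_exp (mul_nonneg hs.le ?_))
      rw [mono_eq_exp hV, Real.exp_le_exp, not_le] at hc
      simp only [mul_neg, Finset.sum_neg_distrib, sum_count_mul_sub hk]
      linarith
  rw [sum_countProb hpsum] at key
  linarith

/-- The squared Hellinger-type distance between the relative wealth profile of `W` and `p`. -/
def hellingerSq {m : ℕ} (p q W : Fin m → ℝ) : ℝ := ∑ i, (√(q i * W i) - √(p i)) ^ 2

theorem hellingerSq_nonneg {m : ℕ} (p q W : Fin m → ℝ) : 0 ≤ hellingerSq p q W :=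
  Finset.sum_nonneg fun _ _ => sq_nonneg _

theorem sum_sqrt_le_exp {m : ℕ} {p q W : Fin m → ℝ} (hp : ∀ i, 0 < p i)
    (hpsum : ∑ i, p i = 1) (hq : ∀ i, 0 < q i) (hW : W ∈ closedSimplex q) :
    ∑ i, p i * √(W i / (p i / q i)) ≤ Real.exp (-hellingerSq p q W / 2) := by
  have e : ∀ i, (√(q i * W i) - √(p i)) ^ 2 =
      q i * W i + p i - 2 * (p i * √(W i / (p i / q i))) := by
    intro i
    have hw : 0 ≤ q i * W i := mul_nonneg (hq i).le (hW.1 i)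
    have h1 : p i * √(W i / (p i / q i)) = √(q i * W i) * √(p i) := by
      rw [show W i / (p i / q i) = q i * W i / p i by
        have := (hp i).ne'; have := (hq i).ne'; field_simp, Real.sqrt_div hw]
      nth_rw 1 [← Real.mul_self_sqrt (hp i).le]
      have := (Real.sqrt_pos.mpr (hp i)).ne'
      field_simp
    rw [h1, sub_sq, Real.sq_sqrt hw, Real.sq_sqrt (hp i).le]
    ring
  have : hellingerSq p q W = 2 - 2 * ∑ i, p i * √(W i / (p i / q i)) := by
    simp only [hellingerSq, e, Finset.sum_sub_distrib, Finset.sum_add_distrib, hW.2, hpsum,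
      ← Finset.mul_sum]
    norm_num
  have := Real.add_one_le_exp (-hellingerSq p q W / 2)
  linarith

/-- Uniform upper bound on the quantile, with a loss governed by the distance to Kelly. -/
theorem eventually_upperQuantile_le {m : ℕ} {p q : Fin m → ℝ} (hp : ∀ i, 0 < p i)
    (hpsum : ∑ i, p i = 1) (hq : ∀ i, 0 < q i) {α : ℝ} (hα0 : 0 < α)
    {δ : ℝ} (hδ : 0 < δ) :
    ∀ᶠ n : ℕ in atTop, ∀ W ∈ closedSimplex q, upperQuantile p n α W ≤
      Real.exp (n * ((∑ i, p i * Real.log (p i / q i)) + δ - hellingerSq p q W)) := by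
  set h := ∑ i, p i * Real.log (p i / q i) with hh
  set V : Fin m → ℝ := fun i => p i / q i with hVdef
  have hV : ∀ i, 0 < V i := fun i => div_pos (hp i) (hq i)
  have hb : ∑ i, p i * (Real.log (V i) - (h + δ / 2)) < 0 := by
    simp only [mul_sub, Finset.sum_sub_distrib, ← Finset.sum_mul, hpsum, hVdef, ← hh]
    linarith
  obtain ⟨s, hs, hs1⟩ := exists_pos_sum_mul_exp_lt_one hpsum hb
  have hs0 : 0 ≤ ∑ i, p i * Real.exp (s * (Real.log (V i) - (h + δ / 2))) :=
    Finset.sum_nonneg fun i _ => mul_nonneg (hp i).le (Real.exp_pos _).le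
  have hexp : Tendsto (fun n : ℕ => Real.exp (n * (δ / 4))) atTop atTop :=
    Real.tendsto_exp_atTop.comp (tendsto_natCast_atTop_atTop.atTop_mul_const (by positivity))
  filter_upwards [(tendsto_pow_atTop_nhds_zero_of_lt_one hs0 hs1).eventually_lt_const
    (half_pos hα0), hexp.eventually_ge_atTop (2 / α)] with n hn hn2 W hW
  refine Real.sSup_le (fun t ⟨ht0, ht⟩ => ?_) (Real.exp_pos _).le
  rcases ht0.eq_or_lt with rfl | htpos
  · exact (Real.exp_pos _).le
  set E := Real.exp (n * (h + δ / 2)) with hE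
  have hEpos : 0 < E := Real.exp_pos _
  set r := √(t / E) with hr
  have hrpos : 0 < r := Real.sqrt_pos.mpr (div_pos htpos hEpos)
  have key : (∑ k ∈ countFinset m n, if t ≤ mono W k then countProb p k else 0) ≤
      (∑ k ∈ countFinset m n, countProb p k *
        ∏ i, Real.exp (s * (Real.log (V i) - (h + δ / 2))) ^ k i) +
      (∑ k ∈ countFinset m n, countProb p k * ∏ i, √(W i / V i) ^ k i) / r := by
    rw [Finset.sum_div, ← Finset.sum_add_distrib]
    refine Finset.sum_le_sum fun k hk => ?_
    have hk0 := countProb_nonneg (fun i => (hp i).le) k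
    have hy0 : 0 ≤ ∏ i, √(W i / V i) ^ k i :=
      Finset.prod_nonneg fun i _ => pow_nonneg (Real.sqrt_nonneg _) _
    have hfst : 0 ≤ countProb p k *
        ∏ i, Real.exp (s * (Real.log (V i) - (h + δ / 2))) ^ k i :=
      mul_nonneg hk0 (Finset.prod_nonneg fun i _ => pow_nonneg (Real.exp_pos _).le _)
    have hsnd : 0 ≤ (countProb p k * ∏ i, √(W i / V i) ^ k i) / r := by positivity
    split_ifs with hc
    · rcases le_total E (mono V k) with hEV | hEV
      · refine le_add_of_le_of_nonneg ?_ hsnd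
        rw [prod_exp_pow]
        refine le_mul_of_one_le_right hk0 (Real.one_le_exp (mul_nonneg hs.le ?_))
        rw [mono_eq_exp hV, hE, Real.exp_le_exp] at hEV
        rw [sum_count_mul_sub hk]
        linarith
      · refine le_add_of_nonneg_of_le hfst ?_
        rw [mul_div_assoc]
        refine le_mul_of_one_le_right hk0 ((one_le_div hrpos).mpr ?_)
        have hVk : 0 < mono V k := Finset.prod_pos fun i _ => pow_pos (hV i) _
        refine Real.sqrt_le_iff.mpr ⟨hy0, ?_⟩
        have hsq : (∏ i, √(W i / V i) ^ k i) ^ 2 = mono W k / mono V k := by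
          rw [← Finset.prod_pow, mono, mono, ← Finset.prod_div_distrib]
          refine Finset.prod_congr rfl fun i _ => ?_
          rw [← pow_mul, mul_comm, pow_mul,
            Real.sq_sqrt (div_nonneg (hW.1 i) (hV i).le), div_pow]
        rw [hsq]
        exact div_le_div₀ (htpos.le.trans hc) hc hVk hEV
    · exact add_nonneg hfst hsnd
  rw [sum_countProb_mul_prod_pow, sum_countProb_mul_prod_pow] at key
  have hsum0 : 0 ≤ ∑ i, p i * √(W i / V i) :=
    Finset.sum_nonneg fun i _ => mul_nonneg (hp i).le (Real.sqrt_nonneg _)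
  have hpow : (∑ i, p i * √(W i / V i)) ^ n ≤ Real.exp (n * (-hellingerSq p q W / 2)) := by
    rw [Real.exp_nat_mul]
    exact pow_le_pow_left₀ hsum0 (sum_sqrt_le_exp hp hpsum hq hW) n
  have hα2 : α / 2 ≤ Real.exp (n * (-hellingerSq p q W / 2)) / r := by
    have := div_le_div_of_nonneg_right hpow hrpos.le
    linarith
  have hrle : r ≤ Real.exp (n * (δ / 4) + n * (-hellingerSq p q W / 2)) := by
    rw [le_div_iff₀ hrpos] at hα2
    rw [Real.exp_add]
    calc r = 2 / α * (α / 2 * r) := by field_simp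
      _ ≤ _ := mul_le_mul hn2 hα2 (by positivity) (Real.exp_pos _).le
  have hr2 := pow_le_pow_left₀ hrpos.le hrle 2
  rw [hr, Real.sq_sqrt (div_pos htpos hEpos).le, div_le_iff₀ hEpos, hE, ← Real.exp_nat_mul,
    ← Real.exp_add] at hr2
  refine hr2.trans_eq (congrArg Real.exp ?_)
  push_cast
  ring

theorem tendsto_of_tendsto_hellingerSq {m : ℕ} {p q : Fin m → ℝ} (hp : ∀ i, 0 < p i)
    (hq : ∀ i, 0 < q i) {W : ℕ → Fin m → ℝ} (hW : ∀ n, W n ∈ closedSimplex q)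
    (h : Tendsto (fun n => hellingerSq p q (W n)) atTop (𝓝 0)) :
    Tendsto W atTop (𝓝 fun i => p i / q i) := by
  refine tendsto_pi_nhds.mpr fun i => ?_
  have h1 : Tendsto (fun n => (√(q i * W n i) - √(p i)) ^ 2) atTop (𝓝 0) :=
    squeeze_zero (fun _ => sq_nonneg _) (fun n => Finset.single_le_sum
      (f := fun j => (√(q j * W n j) - √(p j)) ^ 2) (fun _ _ => sq_nonneg _)
      (Finset.mem_univ i)) h
  have h2 : Tendsto (fun n => √(q i * W n i) - √(p i)) atTop (𝓝 0) := by
    have := h1.sqrt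
    simp only [Real.sqrt_sq_eq_abs, Real.sqrt_zero] at this
    exact (tendsto_zero_iff_abs_tendsto_zero _).mpr this
  have h3 := (((h2.add_const √(p i)).pow 2).div_const (q i))
  simp only [sub_add_cancel, zero_add, Real.sq_sqrt (hp i).le] at h3
  refine h3.congr fun n => ?_
  rw [Real.sq_sqrt (mul_nonneg (hq i).le ((hW n).1 i)), mul_div_cancel_left₀ _ (hq i).ne']

/-- **Asymptotically optimal sequences collapse to Kelly.** If `ε_n ≥ 0`, `ε_n → 0`,
and `Q_{n,α}(W_n) ≥ exp(−n ε_n)·sup_{W ∈ W̄} Q_{n,α}(W)` for every `n`, then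
`W_n → W^K`; moreover the Kelly point itself is asymptotically optimal:
`(1/n) log Q_{n,α}(W^K) − (1/n) log(sup_{W ∈ W̄} Q_{n,α}(W)) → 0`. -/
theorem asymptotically_optimal_collapse (m : ℕ) (hm : 2 ≤ m)
    (p q : Fin m → ℝ) (hp : ∀ i, 0 < p i ∧ p i < 1) (hpsum : ∑ i, p i = 1)
    (hq : ∀ i, 0 < q i) (α : ℝ) (hα : 0 < α ∧ α < 1)
    (ε : ℕ → ℝ) (hε0 : ∀ n, 0 ≤ ε n)
    (hε : Filter.Tendsto ε Filter.atTop (nhds 0))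
    (Wseq : ℕ → (Fin m → ℝ)) (hWmem : ∀ n, Wseq n ∈ closedSimplex q)
    (hWopt : ∀ n : ℕ,
      Real.exp (-(n : ℝ) * ε n) * sSup (upperQuantile p n α '' closedSimplex q) ≤
        upperQuantile p n α (Wseq n)) :
    Filter.Tendsto Wseq Filter.atTop (nhds (fun i => p i / q i)) ∧
    Filter.Tendsto
      (fun n : ℕ =>
        (1 / (n : ℝ)) * Real.log (upperQuantile p n α (fun i => p i / q i)) -
        (1 / (n : ℝ)) * Real.log (sSup (upperQuantile p n α '' closedSimplex q)))
      Filter.atTop (nhds 0) := by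
  have hp0 : ∀ i, 0 < p i := fun i => (hp i).1
  have hKpos : ∀ i, 0 < p i / q i := fun i => div_pos (hp0 i) (hq i)
  have hK : (fun i => p i / q i) ∈ closedSimplex q := by
    refine ⟨fun i => (hKpos i).le, ?_⟩
    rw [← hpsum]
    exact Finset.sum_congr rfl fun i _ => mul_div_cancel₀ _ (hq i).ne'
  set h := ∑ i, p i * Real.log (p i / q i) with hh
  have hlower : ∀ δ > 0, ∀ᶠ n : ℕ in atTop,
      Real.exp (n * (h - δ)) ≤ upperQuantile p n α (fun i => p i / q i) := fun δ hδ =>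
    eventually_exp_le_upperQuantile hp0 hpsum hKpos hα.1 hα.2 hδ
  have hupper : ∀ δ > 0, ∀ᶠ n : ℕ in atTop, ∀ W ∈ closedSimplex q, upperQuantile p n α W ≤
      Real.exp (n * (h + δ - hellingerSq p q W)) := fun δ hδ =>
    eventually_upperQuantile_le hp0 hpsum hq hα.1 hδ
  have hsup : ∀ δ > 0, ∀ᶠ n : ℕ in atTop,
      upperQuantile p n α (fun i => p i / q i) ≤ sSup (upperQuantile p n α '' closedSimplex q) ∧
      sSup (upperQuantile p n α '' closedSimplex q) ≤ Real.exp (n * (h + δ)) := by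
    intro δ hδ
    filter_upwards [hupper δ hδ] with n hn
    have hub : Real.exp (n * (h + δ)) ∈ upperBounds (upperQuantile p n α '' closedSimplex q) := by
      rintro _ ⟨W, hW, rfl⟩
      refine (hn W hW).trans (Real.exp_le_exp.mpr (mul_le_mul_of_nonneg_left ?_ n.cast_nonneg))
      linarith [hellingerSq_nonneg p q W]
    exact ⟨le_csSup ⟨_, hub⟩ ⟨_, hK, rfl⟩, csSup_le ⟨_, _, hK, rfl⟩ hub⟩
  constructor
  · refine tendsto_of_tendsto_hellingerSq hp0 hq hWmem ?_
    refine tendsto_order.mpr ⟨fun a ha => Eventually.of_forall fun n =>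
      ha.trans_le (hellingerSq_nonneg _ _ _), fun a ha => ?_⟩
    have hδ : 0 < a / 4 := by positivity
    filter_upwards [hlower _ hδ, hupper _ hδ, hsup _ hδ, hε.eventually_lt_const hδ,
      eventually_gt_atTop 0] with n h1 h2 h3 h4 hn
    have hn' : (0 : ℝ) < n := Nat.cast_pos.mpr hn
    have h5 : Real.exp (-(n : ℝ) * ε n) * Real.exp (n * (h - a / 4)) ≤
        Real.exp (n * (h + a / 4 - hellingerSq p q (Wseq n))) :=
      (mul_le_mul_of_nonneg_left (h1.trans h3.1) (Real.exp_pos _).le).trans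
        ((hWopt n).trans (h2 _ (hWmem n)))
    rw [← Real.exp_add, Real.exp_le_exp] at h5
    have h6 : (n : ℝ) * (h - a / 4 - ε n) ≤ n * (h + a / 4 - hellingerSq p q (Wseq n)) := by
      linarith
    have := le_of_mul_le_mul_left h6 hn'
    linarith
  · refine Metric.tendsto_nhds.mpr fun a ha => ?_
    have hδ : 0 < a / 4 := by positivity
    filter_upwards [hlower _ hδ, hsup _ hδ, eventually_gt_atTop 0] with n h1 h3 hn
    have hn' : (0 : ℝ) < n := Nat.cast_pos.mpr hn
    have hQ := (Real.exp_pos _).trans_le h1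
    have hS := hQ.trans_le h3.1
    have l1 := (Real.le_log_iff_exp_le hQ).mpr h1
    have l2 := Real.log_le_log hQ h3.1
    have l3 := (Real.log_le_iff_le_exp hS).mpr h3.2
    rw [Real.dist_eq, sub_zero, ← mul_sub, abs_mul, abs_of_pos (one_div_pos.mpr hn'),
      abs_of_nonpos (by linarith), one_div, inv_mul_lt_iff₀ hn']
    have : 0 < (n : ℝ) * a := mul_pos hn' ha
    linarith
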